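/- There is no sequence (a_n)_{n≥0} of positive integers satisfying both of the following for some reals 0 < p₁ < p₂ < 1 and constant c > 0: (i) Σ_{i=0}^∞ (1-p₂)^{a_i} = ∞, and (ii) a_n ≥ c / ∏_{i=0}^{n-1} (1 - (1-p₁)^{a_i}) for all n ≥ 1. -/

import Mathlib

open Filter

/-- A linear lower bound for `1 - exp (-δ x)` on the unit interval. -/
theorem mul_le_one_add_mul_one_sub_exp {δ x : ℝ} (hδ : 0 ≤ δ) (hx₀ : 0 ≤ x) (hx₁ : x ≤ 1) :
    δ * x ≤ (1 + δ) * (1 - Real.exp (-(δ * x))) := by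
  have hE := Real.exp_pos (-(δ * x))
  have hEle : (1 + δ * x) * Real.exp (-(δ * x)) ≤ 1 := by
    calc (1 + δ * x) * Real.exp (-(δ * x))
        ≤ Real.exp (δ * x) * Real.exp (-(δ * x)) := by
          gcongr
          linarith [Real.add_one_le_exp (δ * x)]
      _ = 1 := by rw [← Real.exp_add]; simp
  have hδx : 0 ≤ 1 + δ - δ * x := by nlinarith
  have hquad : 0 ≤ δ ^ 2 * x * (1 - x) * Real.exp (-(δ * x)) := by
    have : 0 ≤ 1 - x := by linarith
    positivity
  nlinarith [mul_le_mul_of_nonneg_left hEle hδx]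

/-- A discrete analogue of `∫ exp (-δ S) dS ≤ (1 + δ) / δ`, for increments in `[0, 1]`. -/
theorem mul_sum_mul_exp_neg_partial_sum_le {δ : ℝ} (hδ : 0 ≤ δ) {x : ℕ → ℝ}
    (hx₀ : ∀ n, 0 ≤ x n) (hx₁ : ∀ n, x n ≤ 1) (N : ℕ) :
    δ * ∑ n ∈ Finset.range N, x n * Real.exp (-(δ * ∑ i ∈ Finset.range n, x i)) ≤
      (1 + δ) * (1 - Real.exp (-(δ * ∑ i ∈ Finset.range N, x i))) := by
  induction N with
  | zero => simp
  | succ N ih =>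
    rw [Finset.sum_range_succ, Finset.sum_range_succ x, mul_add δ (∑ i ∈ Finset.range N, x i),
      neg_add, Real.exp_add]
    nlinarith [mul_le_mul_of_nonneg_left
      (mul_le_one_add_mul_one_sub_exp hδ (hx₀ N) (hx₁ N))
      (Real.exp_pos (-(δ * ∑ i ∈ Finset.range N, x i))).le]

/-- If `x i < 1` then the inverse of `∏ (1 - x i)` is at least `∑ x i`. -/
theorem mul_sum_le_div_prod_one_sub {c : ℝ} (hc : 0 ≤ c) {x : ℕ → ℝ}
    (hx : ∀ n, x n < 1) (n : ℕ) :
    c * ∑ i ∈ Finset.range n, x i ≤ c / ∏ i ∈ Finset.range n, (1 - x i) := by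
  have hpos : 0 < ∏ i ∈ Finset.range n, (1 - x i) :=
    Finset.prod_pos fun i _ => sub_pos.2 (hx i)
  have hle : ∏ i ∈ Finset.range n, (1 - x i) ≤ Real.exp (-∑ i ∈ Finset.range n, x i) := by
    rw [← Finset.sum_neg_distrib, Real.exp_sum]
    exact Finset.prod_le_prod (fun i _ => (sub_pos.2 (hx i)).le)
      fun i _ => Real.one_sub_le_exp_neg (x i)
  rw [div_eq_mul_inv]
  refine mul_le_mul_of_nonneg_left ?_ hc
  calc ∑ i ∈ Finset.range n, x i ≤ Real.exp (∑ i ∈ Finset.range n, x i) := by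
        linarith [Real.add_one_le_exp (∑ i ∈ Finset.range n, x i)]
    _ = (Real.exp (-∑ i ∈ Finset.range n, x i))⁻¹ := by rw [Real.exp_neg, inv_inv]
    _ ≤ _ := inv_anti₀ hpos hle

/-- There is no sequence `(a_n)` of positive integers such that, for some reals
`0 < p₁ < p₂ < 1` and `c > 0`, both `Σ_i (1-p₂)^{a_i} = ∞` and
`a_n ≥ c / ∏_{i<n} (1 - (1-p₁)^{a_i})` for all `n ≥ 1`. -/
theorem no_sequence_with_divergence_and_lower_bound (a : ℕ → ℕ) (ha : ∀ n, 0 < a n)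
    (p₁ p₂ c : ℝ) (hp₁ : 0 < p₁) (hp : p₁ < p₂) (hp₂ : p₂ < 1) (hc : 0 < c)
    (hdiv : Tendsto (fun N => ∑ i ∈ Finset.range N, (1 - p₂) ^ a i) atTop atTop)
    (hlb : ∀ n, 1 ≤ n → (a n : ℝ) ≥ c / ∏ i ∈ Finset.range n, (1 - (1 - p₁) ^ a i)) :
    False := by
  have hq₀ : 0 < 1 - p₁ := by linarith
  have hr₀ : 0 < 1 - p₂ := by linarith
  have hx₀ (n : ℕ) : 0 ≤ (1 - p₁) ^ a n := by positivity
  have hx₁ (n : ℕ) : (1 - p₁) ^ a n < 1 :=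
    pow_lt_one₀ hq₀.le (by linarith) (ha n).ne'
  have hlog : 0 < Real.log ((1 - p₁) / (1 - p₂)) :=
    Real.log_pos ((one_lt_div hr₀).2 (by linarith))
  set l := Real.log ((1 - p₁) / (1 - p₂)) with hl
  have hr : 1 - p₂ = (1 - p₁) * Real.exp (-l) := by
    rw [hl, Real.exp_neg, Real.exp_log (div_pos hq₀ hr₀)]
    field_simp
  have hδ : 0 < l * c := mul_pos hlog hc
  have hgrowth (n : ℕ) : c * ∑ i ∈ Finset.range n, (1 - p₁) ^ a i ≤ a n := by
    rcases Nat.eq_zero_or_pos n with rfl | hn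
    · simp
    · exact (mul_sum_le_div_prod_one_sub hc.le hx₁ n).trans (hlb n hn)
  have hterm (n : ℕ) : (1 - p₂) ^ a n ≤
      (1 - p₁) ^ a n * Real.exp (-(l * c * ∑ i ∈ Finset.range n, (1 - p₁) ^ a i)) := by
    rw [hr, mul_pow, ← Real.exp_nat_mul]
    refine mul_le_mul_of_nonneg_left (Real.exp_le_exp.2 ?_) (hx₀ n)
    nlinarith [mul_le_mul_of_nonneg_left (hgrowth n) hlog.le]
  obtain ⟨N, hN⟩ := (hdiv.eventually_gt_atTop ((1 + l * c) / (l * c))).exists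
  rw [div_lt_iff₀' hδ] at hN
  have hsum := mul_le_mul_of_nonneg_left
    (Finset.sum_le_sum fun n (_ : n ∈ Finset.range N) => hterm n) hδ.le
  have hbound := mul_sum_mul_exp_neg_partial_sum_le hδ.le hx₀ (fun n => (hx₁ n).le) N
  have hexp : 0 ≤ (1 + l * c) *
      Real.exp (-(l * c * ∑ i ∈ Finset.range N, (1 - p₁) ^ a i)) := by positivity
  linarith
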